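/- The field $\mathbb{R}$ of real numbers, regarded as a vector space over the field $\mathbb{Q}$ of rational numbers, has no basis that is closed under multiplication; that is, there is no $\mathbb{Q}$-basis $H$ of $\mathbb{R}$ such that $x \cdot y \in H$ for all $x, y \in H$. -/

import Mathlib

/-- A linear map sending every element of a multiplicatively closed spanning set to `1` is
multiplicative. -/
theorem LinearMap.map_mul_of_eq_one_on_span {K A : Type*} [CommRing K] [CommRing A] [Algebra K A]
    {H : Set A} (hspan : Submodule.span K H = ⊤) (hmul : ∀ x ∈ H, ∀ y ∈ H, x * y ∈ H)
    (φ : A →ₗ[K] K) (hφ : ∀ x ∈ H, φ x = 1) (x y : A) : φ (x * y) = φ x * φ y := by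
  have hx : x ∈ Submodule.span K H := hspan ▸ Submodule.mem_top
  have hy : y ∈ Submodule.span K H := hspan ▸ Submodule.mem_top
  induction hx, hy using Submodule.span_induction₂ with
  | mem_mem x y hx hy => rw [hφ _ (hmul x hx y hy), hφ x hx, hφ y hy, one_mul]
  | zero_left y hy => simp
  | zero_right x hx => simp
  | add_left x y z _ _ _ h₁ h₂ => rw [add_mul, map_add, h₁, h₂, map_add, add_mul]
  | add_right x y z _ _ _ h₁ h₂ => rw [mul_add, map_add, h₁, h₂, map_add, mul_add]
  | smul_left r x y _ _ h => rw [smul_mul_assoc, map_smul, h, map_smul, smul_mul_assoc]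
  | smul_right r x y _ _ h => rw [mul_smul_comm, map_smul, h, map_smul, mul_smul_comm]

/-- The reals, as a vector space over `ℚ`, have no basis closed under multiplication. -/
theorem reals_no_multiplicatively_closed_rational_basis :
    ¬ ∃ H : Set ℝ,
        (LinearIndependent ℚ ((↑) : H → ℝ) ∧ Submodule.span ℚ H = ⊤) ∧
        ∀ x ∈ H, ∀ y ∈ H, x * y ∈ H := by
  rintro ⟨H, ⟨hli, hspan⟩, hmul⟩
  let b : Module.Basis H ℚ ℝ := Module.Basis.mk hli (by simp [hspan])
  let φ : ℝ →ₗ[ℚ] ℚ := b.constr ℚ fun _ => 1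
  have hφ : ∀ x ∈ H, φ x = 1 := fun x hx => by
    simpa [b] using b.constr_basis ℚ (fun _ => (1 : ℚ)) ⟨x, hx⟩
  have hφmul := φ.map_mul_of_eq_one_on_span hspan hmul hφ
  obtain ⟨h, hh⟩ : H.Nonempty := by
    rw [Set.nonempty_iff_ne_empty]
    rintro rfl
    simp at hspan
  have hone : φ 1 = 1 := by
    have := hφmul 1 h
    rwa [one_mul, hφ h hh, mul_one, eq_comm] at this
  have hsq : φ (√2) * φ (√2) = 2 := by
    rw [← hφmul, Real.mul_self_sqrt zero_le_two, ← one_add_one_eq_two, map_add, hone]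
    norm_num
  refine irrational_sqrt_two ⟨|φ (√2)|, ?_⟩
  rw [eq_comm, Real.sqrt_eq_iff_mul_self_eq zero_le_two (by positivity)]
  exact_mod_cast ((abs_mul_abs_self _).trans hsq).symm
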